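/- For every GNN A, there exists a formula φ of the logic K^# such that for every pointed graph (G,u), A accepts (G,u) if and only if (G,u) satisfies φ; that is, ⟦A⟧ = ⟦φ⟧. -/

import Mathlib

/-- A labeled directed graph: finite vertex set, directed edges, and a
labeling of each vertex by a valuation over atomic propositions (ℕ). -/
structure PGraph where
  V : Type
  fintV : Fintype V
  decV : DecidableEq V
  E : V → V → Bool
  label : V → ℕ → Bool

attribute [instance] PGraph.fintV PGraph.decV

mutual
/-- Formulas of the logic K^#. -/
inductive KForm : Type where
  | atom : ℕ → KForm
  | neg : KForm → KForm
  | or : KForm → KForm → KForm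
  | geq : KExpr → KForm          -- ξ ≥ 0
/-- Arithmetic expressions of the logic K^#. -/
inductive KExpr : Type where
  | const : ℤ → KExpr
  | one : KForm → KExpr          -- 1_φ
  | count : KForm → KExpr        -- #φ
  | add : KExpr → KExpr → KExpr
  | mul : ℤ → KExpr → KExpr      -- c × ξ
end

mutual
/-- Truth of a K^# formula at a pointed graph. -/
def KForm.eval (G : PGraph) : G.V → KForm → Bool
  | u, .atom p => G.label u p
  | u, .neg φ => !(KForm.eval G u φ)
  | u, .or φ ψ => KForm.eval G u φ || KForm.eval G u ψ
  | u, .geq ξ => decide (0 ≤ KExpr.eval G u ξ)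
/-- Value of a K^# arithmetic expression at a pointed graph. -/
def KExpr.eval (G : PGraph) : G.V → KExpr → ℤ
  | _, .const c => c
  | u, .one φ => if KForm.eval G u φ then 1 else 0
  | u, .count φ =>
      ((Finset.univ.filter (fun v => G.E u v && KForm.eval G v φ = true)).card : ℤ)
  | u, .add ξ ξ' => KExpr.eval G u ξ + KExpr.eval G u ξ'
  | u, .mul c ξ => c * KExpr.eval G u ξ
end

def KForm.satisfiable (φ : KForm) : Prop := ∃ (G : PGraph) (u : G.V), φ.eval G u = true

def KForm.valid (φ : KForm) : Prop := ∀ (G : PGraph) (u : G.V), φ.eval G u = true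

/-- Truncated ReLU. -/
noncomputable def trunc (x : ℝ) : ℝ := max 0 (min 1 x)

/-- A GNN: `L` layers; layer `t` (for `0 ≤ t < L`) has integer matrices
`C t`, `A t` and integer bias `b t`, mapping states of dimension `dim t` to
states of dimension `dim (t+1)`; `a` gives the integer coefficients of the
final linear classification function. The initial dimension `dim 0` is the
number of atomic propositions used. -/
structure GNN where
  L : ℕ
  dim : ℕ → ℕ
  C : (t : ℕ) → Matrix (Fin (dim t)) (Fin (dim (t + 1))) ℤ
  A : (t : ℕ) → Matrix (Fin (dim t)) (Fin (dim (t + 1))) ℤ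
  b : (t : ℕ) → Fin (dim (t + 1)) → ℤ
  a : Fin (dim L) → ℤ

/-- The state of a GNN on a graph after `t` layers. -/
noncomputable def GNN.state (N : GNN) (G : PGraph) : (t : ℕ) → G.V → Fin (N.dim t) → ℝ
  | 0, u, i => if G.label u i then 1 else 0
  | t + 1, u, j => trunc (
      (∑ i, N.state G t u i * (N.C t i j : ℝ)) +
      (∑ i, (∑ v ∈ Finset.univ.filter (fun v => G.E u v = true), N.state G t v i)
            * (N.A t i j : ℝ)) +
      (N.b t j : ℝ))

/-- The GNN accepts a pointed graph iff `cls(x_L(u)) = 1`, i.e. `Σ a_i x_i ≥ 1`. -/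
noncomputable def GNN.accepts (N : GNN) (G : PGraph) (u : G.V) : Prop :=
  1 ≤ ∑ i, (N.a i : ℝ) * N.state G N.L u i

mutual
/-- Modal depth of a K^# formula. -/
def KForm.md : KForm → ℕ
  | .atom _ => 0
  | .neg φ => φ.md
  | .or φ ψ => max φ.md ψ.md
  | .geq ξ => ξ.md
/-- Modal depth of a K^# expression. -/
def KExpr.md : KExpr → ℕ
  | .const _ => 0
  | .one φ => φ.md
  | .count φ => φ.md + 1
  | .add ξ ξ' => max ξ.md ξ'.md
  | .mul _ ξ => ξ.md
end

mutual
/-- Size (number of syntax-tree nodes) of a K^# formula. -/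
def KForm.size : KForm → ℕ
  | .atom _ => 1
  | .neg φ => φ.size + 1
  | .or φ ψ => φ.size + ψ.size + 1
  | .geq ξ => ξ.size + 1
/-- Size (number of syntax-tree nodes) of a K^# expression. -/
def KExpr.size : KExpr → ℕ
  | .const _ => 1
  | .one φ => φ.size + 1
  | .count φ => φ.size + 1
  | .add ξ ξ' => ξ.size + ξ'.size + 1
  | .mul _ ξ => ξ.size + 2
end

mutual
/-- Atomic propositions occurring in a K^# formula. -/
def KForm.atoms : KForm → Finset ℕ
  | .atom p => {p}
  | .neg φ => φ.atoms
  | .or φ ψ => φ.atoms ∪ ψ.atoms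
  | .geq ξ => ξ.atoms
/-- Atomic propositions occurring in a K^# expression. -/
def KExpr.atoms : KExpr → Finset ℕ
  | .const _ => ∅
  | .one φ => φ.atoms
  | .count φ => φ.atoms
  | .add ξ ξ' => ξ.atoms ∪ ξ'.atoms
  | .mul _ ξ => ξ.atoms
end

/-- Conjunction, defined from ¬ and ∨. -/
def KForm.andF (φ ψ : KForm) : KForm := .neg (.or (.neg φ) (.neg ψ))

/-- Implication, defined from ¬ and ∨. -/
def KForm.impF (φ ψ : KForm) : KForm := .or (.neg φ) ψ

/-- Bi-implication, defined from ¬ and ∨. -/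
def KForm.iffF (φ ψ : KForm) : KForm := KForm.andF (φ.impF ψ) (ψ.impF φ)

/-- The modality □φ, abbreviating `0 − #(¬φ) ≥ 0`. -/
def KForm.box (φ : KForm) : KForm :=
  .geq (.add (.const 0) (.mul (-1) (.count (.neg φ))))

/-- `i`-fold iteration □^i of □. -/
def KForm.boxIter : ℕ → KForm → KForm
  | 0, φ => φ
  | i + 1, φ => KForm.box (KForm.boxIter i φ)

/-- The modality `□^{≤m} φ := ⋀_{0 ≤ i ≤ m} □^i φ`. -/
def KForm.boxUpTo : ℕ → KForm → KForm
  | 0, φ => φ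
  | m + 1, φ => KForm.andF (KForm.boxUpTo m φ) (KForm.boxIter (m + 1) φ)

/-- `#ψ = k`, abbreviating `(#ψ − k ≥ 0) ∧ (k − #ψ ≥ 0)`. -/
def KForm.countEq (ψ : KForm) (k : ℤ) : KForm :=
  KForm.andF (.geq (.add (.count ψ) (.const (-k))))
             (.geq (.add (.const k) (.mul (-1) (.count ψ))))

theorem trunc_intCast (n : ℤ) : trunc n = if 1 ≤ n then 1 else 0 := by
  unfold trunc
  split_ifs with h
  · have h1 : (1 : ℝ) ≤ n := by exact_mod_cast h
    rw [min_eq_left h1, max_eq_right zero_le_one]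
  · have h0 : (n : ℝ) ≤ 0 := by exact_mod_cast (show n ≤ 0 by omega)
    exact max_eq_left ((min_le_right _ _).trans h0)

/-- Expressions of K^# are closed under finite sums. -/
theorem KExpr.exists_eval_eq_sum {ι : Type*} (s : Finset ι) (f : ι → KExpr) :
    ∃ ξ : KExpr, ∀ (G : PGraph) (u : G.V), ξ.eval G u = ∑ i ∈ s, (f i).eval G u := by
  classical
  induction s using Finset.induction_on with
  | empty => exact ⟨.const 0, fun G u => by simp [KExpr.eval]⟩
  | insert a s ha ih =>
    obtain ⟨ξ, hξ⟩ := ih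
    exact ⟨.add (f a) ξ, fun G u => by rw [KExpr.eval, hξ, Finset.sum_insert ha]⟩

theorem KExpr.eval_count_eq_sum (G : PGraph) (u : G.V) (φ : KForm) :
    (KExpr.count φ).eval G u =
      ∑ v ∈ Finset.univ.filter (fun v => G.E u v = true), if φ.eval G v then 1 else 0 := by
  rw [KExpr.eval, Finset.sum_boole, Finset.filter_filter]
  simp

theorem KForm.eval_geq_sub_one (G : PGraph) (u : G.V) (ξ : KExpr) :
    (KForm.geq (.add ξ (.const (-1)))).eval G u = true ↔ 1 ≤ ξ.eval G u := by
  rw [KForm.eval, decide_eq_true_iff, KExpr.eval, KExpr.eval]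
  omega

/-- Each component of each state of a GNN is the indicator of a K^# formula. -/
theorem GNN.exists_state_eq_ite (N : GNN) (t : ℕ) :
    ∃ φ : Fin (N.dim t) → KForm, ∀ (G : PGraph) (u : G.V) (i : Fin (N.dim t)),
      N.state G t u i = if (φ i).eval G u then 1 else 0 := by
  induction t with
  | zero => exact ⟨fun i => .atom i, fun G u i => by
    rw [GNN.state, KForm.eval]⟩
  | succ t ih =>
    obtain ⟨φ, hφ⟩ := ih
    choose ξ hξ using fun j => KExpr.exists_eval_eq_sum Finset.univ fun i =>
      .add (.mul (N.C t i j) (.one (φ i))) (.mul (N.A t i j) (.count (φ i)))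
    refine ⟨fun j => .geq (.add (.add (ξ j) (.const (N.b t j))) (.const (-1))), fun G u j => ?_⟩
    have key : (∑ i, N.state G t u i * (N.C t i j : ℝ)) +
        (∑ i, (∑ v ∈ Finset.univ.filter (fun v => G.E u v = true), N.state G t v i)
            * (N.A t i j : ℝ)) + (N.b t j : ℝ) =
        ((KExpr.add (ξ j) (.const (N.b t j))).eval G u : ℤ) := by
      rw [KExpr.eval, hξ, ← Finset.sum_add_distrib]
      simp only [KExpr.eval.eq_4, KExpr.eval.eq_5, KExpr.eval.eq_1, KExpr.eval.eq_2,
        KExpr.eval_count_eq_sum, hφ]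
      push_cast
      simp only [mul_comm]
    rw [GNN.state, key, trunc_intCast]
    exact if_congr (KForm.eval_geq_sub_one G u _).symm rfl rfl

/-- For every GNN A there is a K^# formula φ with ⟦A⟧ = ⟦φ⟧. -/
theorem from_GNN_to_logic (N : GNN) :
    ∃ φ : KForm, ∀ (G : PGraph) (u : G.V), N.accepts G u ↔ φ.eval G u = true := by
  obtain ⟨φ, hφ⟩ := N.exists_state_eq_ite N.L
  obtain ⟨ξ, hξ⟩ := KExpr.exists_eval_eq_sum Finset.univ fun i => .mul (N.a i) (.one (φ i))
  refine ⟨.geq (.add ξ (.const (-1))), fun G u => ?_⟩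
  rw [KForm.eval_geq_sub_one, hξ, ← Int.cast_le (R := ℝ)]
  simp [GNN.accepts, hφ, KExpr.eval]
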